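/- arXiv:2511.23035 — 3 statements merged into one kernel-verified Lean document; each statement's English description precedes it below -/
import Mathlib

section
/- Let T = ℂ[X_1,...,X_m, Y_1,...,Y_n] act by differentiation on S = ℂ[x_1,...,x_m, y_1,...,y_n], and let F = (x_1^2 + ... + x_m^2)(y_1^2 + ... + y_n^2) with m ≥ 2 and n ≥ 2. Then F^⊥ = ({X_1^2 − X_i^2 : 2 ≤ i ≤ m}, {X_iX_j : 1 ≤ i < j ≤ m}, {Y_1^2 − Y_i^2 : 2 ≤ i ≤ n}, {Y_iY_j : 1 ≤ i < j ≤ n}). -/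
open MvPolynomial
open scoped Classical

/-- Differentiation of `F` by the monomial with exponent vector `m`:
`∂^m F`, defined coefficientwise via descending factorials. -/
noncomputable def contract {σ : Type*} (m : σ →₀ ℕ) (F : MvPolynomial σ ℂ) : MvPolynomial σ ℂ :=
  ∑ k ∈ F.support, monomial (k - m) (F.coeff k * m.prod fun i e => (Nat.descFactorial (k i) e : ℂ))

/-- The apolarity (differentiation) action: `apolar g F = g ∘ F`. -/
noncomputable def apolar {σ : Type*} (g F : MvPolynomial σ ℂ) : MvPolynomial σ ℂ :=
  ∑ m ∈ g.support, g.coeff m • contract m F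

/-- Up to the factorials of the exponents, the coefficients of `contract d F` are those of `F`
shifted by `d`. -/
theorem factorial_mul_coeff_contract {σ : Type*} [Fintype σ] (F : MvPolynomial σ ℂ)
    (e d : σ →₀ ℕ) :
    (∏ i, ((e i).factorial : ℂ)) * (contract d F).coeff e =
      (∏ i, (((e + d) i).factorial : ℂ)) * F.coeff (e + d) := by
  have key : ∀ k ∈ F.support, (∏ i, ((e i).factorial : ℂ)) *
      (monomial (k - d) (F.coeff k * d.prod fun i r => (Nat.descFactorial (k i) r : ℂ))).coeff e =
      if k = e + d then (∏ i, (((e + d) i).factorial : ℂ)) * F.coeff (e + d) else 0 := by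
    intro k _
    rw [coeff_monomial, Finsupp.prod_fintype _ _ (by simp)]
    by_cases hk : k = e + d
    · subst hk
      rw [if_pos (by simp), if_pos rfl, mul_left_comm, ← Finset.prod_mul_distrib, mul_comm]
      congr 1
      refine Finset.prod_congr rfl fun i _ => ?_
      have := Nat.factorial_mul_descFactorial (n := (e + d) i) (k := d i) (by simp)
      rw [← this]
      simp
    · rw [if_neg hk]
      split_ifs with h
      · have : ∃ i, k i < d i := by
          by_contra! hle
          exact hk (by ext i; have := hle i; simp [← h]; omega)
        obtain ⟨i, hi⟩ := this
        have hz : ((k i).descFactorial (d i) : ℂ) = 0 :=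
          Nat.cast_eq_zero.2 (Nat.descFactorial_eq_zero_iff_lt.2 hi)
        have hprod : ∏ i, ((k i).descFactorial (d i) : ℂ) = 0 :=
          Finset.prod_eq_zero (Finset.mem_univ i) hz
        rw [hprod, mul_zero, mul_zero]
      · simp
  rw [contract, coeff_sum, Finset.mul_sum, Finset.sum_congr rfl key, Finset.sum_ite_eq']
  split_ifs with h
  · rfl
  · rw [notMem_support_iff.1 h, mul_zero]

/-- The sum of the coefficients of a polynomial at the monomials of
`(x_1^2 + ⋯ + x_m^2)(y_1^2 + ⋯ + y_n^2)`. -/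
noncomputable def biquadraticSum (ι κ : Type*) [Fintype ι] [Fintype κ] :
    MvPolynomial (ι ⊕ κ) ℂ →ₗ[ℂ] ℂ :=
  ∑ i : ι, ∑ j : κ, lcoeff ℂ ((Finsupp.single i 2).sumElim (Finsupp.single j 2))

/-- The number of indices `i` with `a` the exponent of `x_i^2`. -/
noncomputable def squareCount {ι : Type*} [Fintype ι] (a : ι →₀ ℕ) : ℂ :=
  ∑ i : ι, if Finsupp.single i 2 = a then 1 else 0

theorem sumElim_eq_sumElim_iff {ι κ : Type*} {a a' : ι →₀ ℕ} {b b' : κ →₀ ℕ} :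
    a.sumElim b = a'.sumElim b' ↔ a = a' ∧ b = b' := by
  simp [Finsupp.ext_iff]

section

variable {ι κ : Type*} [Fintype ι] [Fintype κ]

theorem biquadraticSum_monomial (a : ι →₀ ℕ) (b : κ →₀ ℕ) (c : ℂ) :
    biquadraticSum ι κ (monomial (a.sumElim b) c) = c * (squareCount a * squareCount b) := by
  simp only [biquadraticSum, squareCount, LinearMap.sum_apply, lcoeff_apply, coeff_monomial,
    Finset.sum_mul_sum, sumElim_eq_sumElim_iff]
  simp only [Finset.mul_sum]
  refine Finset.sum_congr rfl fun i _ => Finset.sum_congr rfl fun j _ => ?_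
  have ha := @eq_comm _ a (Finsupp.single i 2)
  have hb := @eq_comm _ b (Finsupp.single j 2)
  by_cases h : Finsupp.single i 2 = a <;> by_cases h' : Finsupp.single j 2 = b <;>
    simp [ha, hb, h, h']

theorem prod_factorial_single_two (i : ι) :
    ∏ s, ((Finsupp.single i 2 s).factorial : ℂ) = 2 := by
  rw [Finset.prod_eq_single i] <;> simp +contextual [eq_comm]

theorem prod_factorial_mul_coeff (k : ι ⊕ κ →₀ ℕ) :
    (∏ s, ((k s).factorial : ℂ)) *
      ((∑ i : ι, X (Sum.inl i) ^ 2) * ∑ j : κ, X (Sum.inr j) ^ 2 :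
        MvPolynomial (ι ⊕ κ) ℂ).coeff k = 4 * biquadraticSum ι κ (monomial k 1) := by
  simp only [biquadraticSum, LinearMap.sum_apply, lcoeff_apply, coeff_monomial,
    Finset.sum_mul_sum, coeff_sum, X_pow_eq_monomial, monomial_mul]
  simp only [Finset.mul_sum]
  refine Finset.sum_congr rfl fun i _ => Finset.sum_congr rfl fun j _ => ?_
  rw [← Finsupp.sumElim_single_single]
  by_cases h : (Finsupp.single i 2).sumElim (Finsupp.single j 2) = k
  · subst h
    simp only [Fintype.prod_sum_type, Finsupp.sumElim_inl, Finsupp.sumElim_inr]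
    rw [prod_factorial_single_two, prod_factorial_single_two]
    norm_num
  · rw [if_neg h, if_neg (Ne.symm h)]
    simp

theorem apolar_eq_zero_iff (g : MvPolynomial (ι ⊕ κ) ℂ) :
    apolar g ((∑ i : ι, X (Sum.inl i) ^ 2) * ∑ j : κ, X (Sum.inr j) ^ 2) = 0 ↔
      ∀ e, biquadraticSum ι κ (monomial e 1 * g) = 0 := by
  have key : ∀ e : ι ⊕ κ →₀ ℕ, (∏ s, ((e s).factorial : ℂ)) *
      (apolar g ((∑ i : ι, X (Sum.inl i) ^ 2) * ∑ j : κ, X (Sum.inr j) ^ 2)).coeff e =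
      4 * biquadraticSum ι κ (monomial e 1 * g) := by
    intro e
    conv_rhs => rw [g.as_sum]
    rw [apolar, coeff_sum, Finset.mul_sum g.support, Finset.mul_sum g.support, map_sum,
      Finset.mul_sum g.support]
    refine Finset.sum_congr rfl fun d _ => ?_
    rw [coeff_smul, smul_eq_mul, monomial_mul, one_mul, mul_left_comm,
      factorial_mul_coeff_contract, prod_factorial_mul_coeff, mul_left_comm,
      ← smul_eq_mul (g.coeff d), ← map_smul,
      smul_monomial, smul_eq_mul, mul_one]
  rw [MvPolynomial.ext_iff]
  refine forall_congr' fun e => ?_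
  have hne : (∏ s, ((e s).factorial : ℂ)) ≠ 0 :=
    Finset.prod_ne_zero_iff.2 fun s _ => Nat.cast_ne_zero.2 (Nat.factorial_ne_zero _)
  rw [coeff_zero, ← mul_right_inj' hne, key, mul_zero, mul_eq_zero]
  norm_num

theorem squareCount_single_two (i : ι) : squareCount (Finsupp.single i 2) = 1 := by
  simp [squareCount, Finsupp.single_left_inj]

theorem squareCount_eq_zero {a : ι →₀ ℕ} (h : ∀ i, Finsupp.single i 2 ≠ a) :
    squareCount a = 0 := by
  simp [squareCount, h]

theorem squareCount_add_single_two (a : ι →₀ ℕ) (i : ι) :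
    squareCount (a + Finsupp.single i 2) = if a = 0 then 1 else 0 := by
  split_ifs with h
  · simp [h, squareCount_single_two]
  · refine squareCount_eq_zero fun j hj => h ?_
    have hij : j = i := by
      by_contra hij
      have := DFunLike.congr_fun hj i
      simp [hij] at this
    subst hij
    simpa using hj

theorem squareCount_add_single_add_single (a : ι →₀ ℕ) {i j : ι} (hij : i ≠ j) :
    squareCount (a + (Finsupp.single i 1 + Finsupp.single j 1)) = 0 := by
  refine squareCount_eq_zero fun l hl => ?_
  have h₁ := DFunLike.congr_fun hl i
  have h₂ := DFunLike.congr_fun hl j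
  simp only [Finsupp.add_apply, Finsupp.single_apply] at h₁ h₂
  grind

/-- The exponents of the monomials `1`, `x_o^2` and `x_i`. -/
noncomputable def stdExponent (o : ι) : Option (Option ι) → ι →₀ ℕ
  | none => 0
  | some none => Finsupp.single o 2
  | some (some i) => Finsupp.single i 1

/-- The exponents complementary to those of `stdExponent`. -/
noncomputable def dualExponent (o : ι) : Option (Option ι) → ι →₀ ℕ
  | none => Finsupp.single o 2
  | some none => 0
  | some (some i) => Finsupp.single i 1

theorem squareCount_dual_add_std (o : ι) (s t : Option (Option ι)) :
    squareCount (dualExponent o s + stdExponent o t) = if s = t then 1 else 0 := by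
  have h0 : squareCount (0 : ι →₀ ℕ) = 0 := squareCount_eq_zero fun i => by simp
  have h1 (i : ι) : squareCount (Finsupp.single i 1) = 0 := squareCount_eq_zero fun j hj => by
    have := congrArg Finsupp.degree hj
    simp at this
  have h2 (i j : ι) : squareCount (Finsupp.single i 1 + Finsupp.single j 1) =
      if i = j then 1 else 0 := by
    split_ifs with h
    · rw [h, ← Finsupp.single_add, squareCount_single_two]
    · simpa using squareCount_add_single_add_single 0 h
  rcases s with _ | _ | i <;> rcases t with _ | _ | j <;>
    simp [dualExponent, stdExponent, squareCount_single_two, squareCount_add_single_two, h0, h1,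
      h2, add_comm (Finsupp.single o 2)]

theorem biquadraticSum_mul_monomial (a a' : ι →₀ ℕ) (b b' : κ →₀ ℕ) :
    biquadraticSum ι κ (monomial (a.sumElim b) 1 * monomial (a'.sumElim b') 1) =
      squareCount (a + a') * squareCount (b + b') := by
  rw [monomial_mul, ← Finsupp.sumElim_add, biquadraticSum_monomial]
  simp

end

/-- If all `v i ^ 2` agree and `v i * v j = 0` for `i ≠ j`, the elements `0`, `1`, `v o ^ 2` and
`v i` are stable under multiplication by `v i`. -/
theorem mul_std_eq_zero_or {R ι : Type*} [CommRing R] [Nontrivial ι] (o : ι) (v : ι → R)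
    (hsq : ∀ i, v i ^ 2 = v o ^ 2) (hmul : ∀ i j, i ≠ j → v i * v j = 0) (i : ι)
    (s : Option (Option ι)) :
    v i * s.elim 1 (fun t => t.elim (v o ^ 2) v) = 0 ∨
      ∃ s' : Option (Option ι), v i * s.elim 1 (fun t => t.elim (v o ^ 2) v) =
        s'.elim 1 (fun t => t.elim (v o ^ 2) v) := by
  rcases s with _ | _ | j
  · exact .inr ⟨some (some i), by simp⟩
  · left
    obtain ⟨j, hj⟩ := exists_ne i
    simp only [Option.elim]
    rw [← hsq j, pow_two, ← mul_assoc, hmul i j hj.symm, zero_mul]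
  · by_cases hij : i = j
    · exact .inr ⟨some none, by simp [hij, ← hsq j, pow_two]⟩
    · exact .inl (by simp [hmul i j hij])

/-- Modulo an ideal containing the differences of squares and the mixed products of each group of
variables, every polynomial is a combination of the standard monomials. -/
theorem exists_sub_sum_monomial_mem {ι κ : Type*} [Fintype ι] [Fintype κ] [Nontrivial ι]
    [Nontrivial κ] (o : ι) (p : κ) (I : Ideal (MvPolynomial (ι ⊕ κ) ℂ))
    (hsq : ∀ i, X (Sum.inl o) ^ 2 - X (Sum.inl i) ^ 2 ∈ I)
    (hmul : ∀ i j, i ≠ j → X (Sum.inl i) * X (Sum.inl j) ∈ I)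
    (hsq' : ∀ i, X (Sum.inr p) ^ 2 - X (Sum.inr i) ^ 2 ∈ I)
    (hmul' : ∀ i j, i ≠ j → X (Sum.inr i) * X (Sum.inr j) ∈ I)
    (g : MvPolynomial (ι ⊕ κ) ℂ) :
    ∃ c : Option (Option ι) × Option (Option κ) → ℂ,
      g - ∑ s, c s • monomial ((stdExponent o s.1).sumElim (stdExponent p s.2)) 1 ∈ I := by
  let q := Ideal.Quotient.mkₐ ℂ I
  let v : ι → MvPolynomial (ι ⊕ κ) ℂ ⧸ I := fun i => q (X (Sum.inl i))
  let w : κ → MvPolynomial (ι ⊕ κ) ℂ ⧸ I := fun j => q (X (Sum.inr j))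
  have hq {x : MvPolynomial (ι ⊕ κ) ℂ} : q x = 0 ↔ x ∈ I := Ideal.Quotient.eq_zero_iff_mem
  have hv := mul_std_eq_zero_or o v
    (fun i => by
      rw [eq_comm, ← sub_eq_zero]
      simpa [v] using hq.2 (hsq i))
    (fun i j hij => by simpa [v] using hq.2 (hmul i j hij))
  have hw := mul_std_eq_zero_or p w
    (fun i => by
      rw [eq_comm, ← sub_eq_zero]
      simpa [w] using hq.2 (hsq' i))
    (fun i j hij => by simpa [w] using hq.2 (hmul' i j hij))
  let f : Option (Option ι) × Option (Option κ) → MvPolynomial (ι ⊕ κ) ℂ ⧸ I := fun s =>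
    s.1.elim 1 (fun t => t.elim (v o ^ 2) v) * s.2.elim 1 (fun t => t.elim (w p ^ 2) w)
  have hf : ∀ s, q (monomial ((stdExponent o s.1).sumElim (stdExponent p s.2)) 1) = f s := by
    intro s
    rw [Finsupp.sumElim_eq_add, ← one_mul (1 : ℂ), ← monomial_mul, map_mul]
    simp only [f]
    congr 1
    · rcases s.1 with _ | _ | i
      · simp [stdExponent]
      · simp [stdExponent, v, ← map_pow, X_pow_eq_monomial]
      · simp [stdExponent, v, X]
    · rcases s.2 with _ | _ | i
      · simp [stdExponent]
      · simp [stdExponent, w, ← map_pow, X_pow_eq_monomial]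
      · simp [stdExponent, w, X]
  have hspan : ∀ z, ∀ x ∈ Submodule.span ℂ (Set.range f),
      q (X z) * x ∈ Submodule.span ℂ (Set.range f) := by
    intro z x hx
    induction hx using Submodule.span_induction with
    | mem x hx =>
      obtain ⟨⟨s, t⟩, rfl⟩ := hx
      rcases z with i | j
      · change v i * (_ * _) ∈ _
        rw [← mul_assoc]
        rcases hv i s with h | ⟨s', h⟩
        · simp only [h, zero_mul, Submodule.zero_mem]
        · rw [h]
          exact Submodule.subset_span ⟨(s', t), rfl⟩
      · change w j * (_ * _) ∈ _
        rw [mul_left_comm]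
        rcases hw j t with h | ⟨t', h⟩
        · simp only [h, mul_zero, Submodule.zero_mem]
        · rw [h]
          exact Submodule.subset_span ⟨(s, t'), rfl⟩
    | zero => simp
    | add x y _ _ hx hy => rw [mul_add]; exact add_mem hx hy
    | smul a x _ hx => rw [mul_smul_comm]; exact Submodule.smul_mem _ _ hx
  have hg : q g ∈ Submodule.span ℂ (Set.range f) := by
    induction g using MvPolynomial.induction_on with
    | C a =>
      rw [← mul_one (C a), ← smul_eq_C_mul, map_smul]
      exact Submodule.smul_mem _ _ (Submodule.subset_span ⟨(none, none), by simp [f]⟩)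
    | add x y hx hy => rw [map_add]; exact add_mem hx hy
    | mul_X x z hx => rw [mul_comm, map_mul]; exact hspan z _ hx
  obtain ⟨c, hc⟩ := (Submodule.mem_span_range_iff_exists_fun ℂ).1 hg
  refine ⟨c, hq.1 ?_⟩
  rw [map_sub, map_sum, ← hc, sub_eq_zero]
  exact Finset.sum_congr rfl fun s _ => by rw [map_smul, hf]

theorem biquadraticSum_mul_eq_zero_of_mem_span {ι κ : Type*} [Fintype ι] [Fintype κ]
    {G : Set (MvPolynomial (ι ⊕ κ) ℂ)}
    (hG : ∀ x ∈ G, ∀ a b, biquadraticSum ι κ (monomial (Finsupp.sumElim a b) 1 * x) = 0)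
    {g : MvPolynomial (ι ⊕ κ) ℂ} (hg : g ∈ Ideal.span G) (h : MvPolynomial (ι ⊕ κ) ℂ) :
    biquadraticSum ι κ (h * g) = 0 := by
  induction hg using Submodule.span_induction generalizing h with
  | mem x hx =>
    induction h using MvPolynomial.induction_on' with
    | monomial e c =>
      obtain ⟨⟨a, b⟩, rfl⟩ := Finsupp.sumFinsuppEquivProdFinsupp.symm.surjective e
      rw [← mul_one c, ← smul_eq_mul c, ← smul_monomial, smul_mul_assoc, map_smul]
      exact smul_eq_zero_of_right _ (hG x hx a b)
    | add x y hx hy => rw [add_mul, map_add, hx, hy, add_zero]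
  | zero => simp
  | add x y _ _ hx hy => rw [mul_add, map_add, hx, hy, add_zero]
  | smul a x _ hx => rw [smul_eq_mul, ← mul_assoc]; exact hx _

/-- For `F = (x_1^2 + ⋯ + x_m^2)(y_1^2 + ⋯ + y_n^2)` with `m, n ≥ 2`, the annihilator
`F^⊥` equals the ideal
`({X_1^2 − X_i^2}, {X_iX_j}_{i<j}, {Y_1^2 − Y_i^2}, {Y_iY_j}_{i<j})`. -/
theorem statement2 (m n : ℕ) (hm : 2 ≤ m) (hn : 2 ≤ n) :
    ∀ g : MvPolynomial (Fin m ⊕ Fin n) ℂ,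
      apolar g ((∑ i, (X (Sum.inl i)) ^ 2) * ∑ j, (X (Sum.inr j)) ^ 2) = 0 ↔
      g ∈ Ideal.span
        ({p : MvPolynomial (Fin m ⊕ Fin n) ℂ | ∃ i : Fin m, i ≠ ⟨0, by omega⟩ ∧
            p = X (Sum.inl (⟨0, by omega⟩ : Fin m)) ^ 2 - X (Sum.inl i) ^ 2} ∪
         {p | ∃ i j : Fin m, i < j ∧ p = X (Sum.inl i) * X (Sum.inl j)} ∪
         {p | ∃ i : Fin n, i ≠ ⟨0, by omega⟩ ∧
            p = X (Sum.inr (⟨0, by omega⟩ : Fin n)) ^ 2 - X (Sum.inr i) ^ 2} ∪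
         {p | ∃ i j : Fin n, i < j ∧ p = X (Sum.inr i) * X (Sum.inr j)}) := by
  intro g
  have : Nontrivial (Fin m) := Fin.nontrivial_iff_two_le.2 hm
  have : Nontrivial (Fin n) := Fin.nontrivial_iff_two_le.2 hn
  set o : Fin m := ⟨0, by omega⟩ 
  set p : Fin n := ⟨0, by omega⟩ 
  have hl (i : Fin m) : (X (Sum.inl i) : MvPolynomial (Fin m ⊕ Fin n) ℂ) =
      monomial ((Finsupp.single i 1).sumElim 0) 1 := by simp [X]
  have hr (j : Fin n) : (X (Sum.inr j) : MvPolynomial (Fin m ⊕ Fin n) ℂ) =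
      monomial (Finsupp.sumElim 0 (Finsupp.single j 1)) 1 := by simp [X]
  have hl2 (i : Fin m) : (X (Sum.inl i) ^ 2 : MvPolynomial (Fin m ⊕ Fin n) ℂ) =
      monomial ((Finsupp.single i 2).sumElim 0) 1 := by simp [X_pow_eq_monomial]
  have hr2 (j : Fin n) : (X (Sum.inr j) ^ 2 : MvPolynomial (Fin m ⊕ Fin n) ℂ) =
      monomial (Finsupp.sumElim 0 (Finsupp.single j 2)) 1 := by simp [X_pow_eq_monomial]
  rw [apolar_eq_zero_iff]
  set G : Set (MvPolynomial (Fin m ⊕ Fin n) ℂ) :=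
      ({q : MvPolynomial (Fin m ⊕ Fin n) ℂ | ∃ i : Fin m, i ≠ o ∧
          q = X (Sum.inl o) ^ 2 - X (Sum.inl i) ^ 2} ∪
        {q | ∃ i j : Fin m, i < j ∧ q = X (Sum.inl i) * X (Sum.inl j)} ∪
        {q | ∃ i : Fin n, i ≠ p ∧ q = X (Sum.inr p) ^ 2 - X (Sum.inr i) ^ 2} ∪
        {q | ∃ i j : Fin n, i < j ∧ q = X (Sum.inr i) * X (Sum.inr j)})
  have hgen : ∀ x ∈ G, ∀ a b,
      biquadraticSum (Fin m) (Fin n) (monomial (Finsupp.sumElim a b) 1 * x) = 0 := by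
    rintro x (((⟨i, -, rfl⟩ | ⟨i, j, hij, rfl⟩) | ⟨i, -, rfl⟩) | ⟨i, j, hij, rfl⟩) a b
    · rw [mul_sub, map_sub, hl2, hl2]
      simp only [biquadraticSum_mul_monomial, squareCount_add_single_two, sub_self]
    · rw [hl, hl, monomial_mul, ← Finsupp.sumElim_add, mul_one, biquadraticSum_mul_monomial,
        squareCount_add_single_add_single a hij.ne, zero_mul]
    · rw [mul_sub, map_sub, hr2, hr2]
      simp only [biquadraticSum_mul_monomial, squareCount_add_single_two, sub_self]
    · rw [hr, hr, monomial_mul, ← Finsupp.sumElim_add, mul_one, biquadraticSum_mul_monomial,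
        squareCount_add_single_add_single b hij.ne, mul_zero]
  refine ⟨fun hg => ?_, fun hg e => biquadraticSum_mul_eq_zero_of_mem_span hgen hg _⟩
  have hsq (i : Fin m) : X (Sum.inl o) ^ 2 - X (Sum.inl i) ^ 2 ∈ Ideal.span G := by
    by_cases hi : i = o
    · simp [hi]
    · exact Ideal.subset_span (.inl (.inl (.inl ⟨i, hi, rfl⟩)))
  have hmul (i j : Fin m) (hij : i ≠ j) : X (Sum.inl i) * X (Sum.inl j) ∈ Ideal.span G := by
    rcases hij.lt_or_gt with hij | hij
    · exact Ideal.subset_span (.inl (.inl (.inr ⟨i, j, hij, rfl⟩)))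
    · exact Ideal.subset_span (.inl (.inl (.inr ⟨j, i, hij, mul_comm _ _⟩)))
  have hsq' (i : Fin n) : X (Sum.inr p) ^ 2 - X (Sum.inr i) ^ 2 ∈ Ideal.span G := by
    by_cases hi : i = p
    · simp [hi]
    · exact Ideal.subset_span (.inl (.inr ⟨i, hi, rfl⟩))
  have hmul' (i j : Fin n) (hij : i ≠ j) : X (Sum.inr i) * X (Sum.inr j) ∈ Ideal.span G := by
    rcases hij.lt_or_gt with hij | hij
    · exact Ideal.subset_span (.inr ⟨i, j, hij, rfl⟩)
    · exact Ideal.subset_span (.inr ⟨j, i, hij, mul_comm _ _⟩)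
  obtain ⟨c, hc⟩ := exists_sub_sum_monomial_mem o p (Ideal.span G) hsq hmul hsq' hmul' g
  have hzero (s : Option (Option (Fin m)) × Option (Option (Fin n))) : c s = 0 := by
    have h := biquadraticSum_mul_eq_zero_of_mem_span hgen hc
      (monomial ((dualExponent o s.1).sumElim (dualExponent p s.2)) 1)
    rw [mul_sub, map_sub, hg, zero_sub, neg_eq_zero, Finset.mul_sum, map_sum] at h
    rw [← h, Finset.sum_eq_single s]
    · rw [mul_smul_comm, map_smul, biquadraticSum_mul_monomial, squareCount_dual_add_std,
        squareCount_dual_add_std]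
      simp
    · intro t _ hts
      rw [mul_smul_comm, map_smul, biquadraticSum_mul_monomial, squareCount_dual_add_std,
        squareCount_dual_add_std]
      by_cases h₁ : s.1 = t.1
      · have h₂ : s.2 ≠ t.2 := fun h₂ => hts (Prod.ext h₁ h₂).symm
        simp [h₂]
      · simp [h₁]
    · simp
  simpa [hzero] using hc
end

section
/- Let F = x(y_1^3 + y_2^3) ∈ ℂ[x, y_1, y_2]. Then both ideals I_1 = (Y_1Y_2, X^3 + Y_1^3 − Y_2^3) and I_2 = (X^2 + Y_1Y_2, X^3 + Y_1^3 − Y_2^3) in T = ℂ[X, Y_1, Y_2] are contained in F^⊥, and each defines a reduced set of 6 distinct points in ℙ^2. -/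
open MvPolynomial
open scoped Classical

/-- Homogeneous vanishing ideal of a set of projective points: all polynomials
vanishing on the corresponding lines through the origin. -/
noncomputable def projVanishingIdeal {σ : Type*} (S : Set (Projectivization ℂ (σ → ℂ))) :
    Ideal (MvPolynomial σ ℂ) :=
  ⨅ P ∈ S, ⨅ c : ℂ, RingHom.ker (MvPolynomial.eval (c • P.rep))

theorem contract_eq_sum_of_subset {σ : Type*} (m : σ →₀ ℕ) (F : MvPolynomial σ ℂ)
    {s : Finset (σ →₀ ℕ)} (hs : F.support ⊆ s) :
    contract m F = ∑ k ∈ s,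
      monomial (k - m) (F.coeff k * m.prod fun i e => (Nat.descFactorial (k i) e : ℂ)) := by
  refine Finset.sum_subset hs fun k _ hk => ?_
  simp [notMem_support_iff.1 hk]

theorem contract_zero {σ : Type*} (m : σ →₀ ℕ) : contract m (0 : MvPolynomial σ ℂ) = 0 := by
  simp [contract]

theorem contract_add {σ : Type*} (m : σ →₀ ℕ) (F G : MvPolynomial σ ℂ) :
    contract m (F + G) = contract m F + contract m G := by
  rw [contract_eq_sum_of_subset m (F + G) support_add,
    contract_eq_sum_of_subset m F (Finset.subset_union_left (s₂ := G.support)),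
    contract_eq_sum_of_subset m G (Finset.subset_union_right (s₁ := F.support)),
    ← Finset.sum_add_distrib]
  refine Finset.sum_congr rfl fun k _ => ?_
  rw [coeff_add, add_mul, map_add]

theorem contract_monomial {σ : Type*} (m k : σ →₀ ℕ) (a : ℂ) :
    contract m (monomial k a) =
      monomial (k - m) (a * m.prod fun i e => (Nat.descFactorial (k i) e : ℂ)) := by
  rw [contract_eq_sum_of_subset m _ support_monomial_subset]
  simp

theorem contract_smul {σ : Type*} (m : σ →₀ ℕ) (a : ℂ) (F : MvPolynomial σ ℂ) :
    contract m (a • F) = a • contract m F := by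
  rw [contract_eq_sum_of_subset m (a • F) (Finsupp.support_smul : _ ⊆ F.support), contract,
    Finset.smul_sum]
  refine Finset.sum_congr rfl fun k _ => ?_
  rw [coeff_smul, smul_monomial, smul_eq_mul, smul_eq_mul, mul_assoc]

theorem contract_contract {σ : Type*} (m n : σ →₀ ℕ) (F : MvPolynomial σ ℂ) :
    contract m (contract n F) = contract (m + n) F := by
  induction F using MvPolynomial.induction_on' with
  | monomial k a =>
    rw [contract_monomial, contract_monomial, contract_monomial, tsub_tsub, add_comm n m,
      mul_assoc]
    congr 2
    have hm : m.support ⊆ m.support ∪ n.support := Finset.subset_union_left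
    have hn : n.support ⊆ m.support ∪ n.support := Finset.subset_union_right
    rw [Finsupp.prod_of_support_subset m hm _ (by simp),
      Finsupp.prod_of_support_subset n hn _ (by simp),
      Finsupp.prod_of_support_subset (m + n) Finsupp.support_add _ (by simp),
      ← Finset.prod_mul_distrib]
    refine Finset.prod_congr rfl fun i _ => ?_
    have h := Nat.descFactorial_mul_descFactorial (n := k i) (Nat.le_add_left (n i) (m i))
    rw [Nat.add_sub_cancel] at h
    rw [mul_comm, Finsupp.tsub_apply, Finsupp.add_apply, ← h, Nat.cast_mul]
  | add p q hp hq => rw [contract_add, contract_add, contract_add, hp, hq]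

theorem apolar_eq_sum_of_subset {σ : Type*} (g F : MvPolynomial σ ℂ)
    {s : Finset (σ →₀ ℕ)} (hs : g.support ⊆ s) :
    apolar g F = ∑ m ∈ s, g.coeff m • contract m F := by
  refine Finset.sum_subset hs fun k _ hk => ?_
  simp [notMem_support_iff.1 hk]

theorem apolar_monomial {σ : Type*} (m : σ →₀ ℕ) (a : ℂ) (F : MvPolynomial σ ℂ) :
    apolar (monomial m a) F = a • contract m F := by
  rw [apolar_eq_sum_of_subset _ _ support_monomial_subset]
  simp

theorem zero_apolar {σ : Type*} (F : MvPolynomial σ ℂ) : apolar 0 F = 0 := by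
  simp [apolar]

theorem add_apolar {σ : Type*} (g h F : MvPolynomial σ ℂ) :
    apolar (g + h) F = apolar g F + apolar h F := by
  rw [apolar_eq_sum_of_subset (g + h) F support_add,
    apolar_eq_sum_of_subset g F (Finset.subset_union_left (s₂ := h.support)),
    apolar_eq_sum_of_subset h F (Finset.subset_union_right (s₁ := g.support)),
    ← Finset.sum_add_distrib]
  refine Finset.sum_congr rfl fun k _ => ?_
  rw [coeff_add, add_smul]

theorem monomial_mul_apolar {σ : Type*} (m : σ →₀ ℕ) (a : ℂ) (g F : MvPolynomial σ ℂ) :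
    apolar (monomial m a * g) F = a • contract m (apolar g F) := by
  induction g using MvPolynomial.induction_on' with
  | monomial n b =>
    rw [monomial_mul, apolar_monomial, apolar_monomial, contract_smul, contract_contract, mul_smul]
  | add p q hp hq => rw [mul_add, add_apolar, add_apolar, contract_add, smul_add, hp, hq]

/-- The annihilator `F^⊥` of `F` under the apolarity action. -/
noncomputable def apolarIdeal {σ : Type*} (F : MvPolynomial σ ℂ) : Ideal (MvPolynomial σ ℂ) where
  carrier := {g | apolar g F = 0}
  zero_mem' := zero_apolar F
  add_mem' {g h} hg hh := by
    simp only [Set.mem_ofPred_eq] at hg hh ⊢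
    rw [add_apolar, hg, hh, add_zero]
  smul_mem' q g hg := by
    simp only [Set.mem_ofPred_eq, smul_eq_mul] at hg ⊢
    induction q using MvPolynomial.induction_on' with
    | monomial n b => rw [monomial_mul_apolar, hg, contract_zero, smul_zero]
    | add p q hp hq => rw [add_mul, add_apolar, hp, hq, add_zero]

theorem mem_apolarIdeal {σ : Type*} {g F : MvPolynomial σ ℂ} :
    g ∈ apolarIdeal F ↔ apolar g F = 0 := Iff.rfl

theorem mem_projVanishingIdeal_image_mk {σ κ : Type*} [Fintype κ] (p : κ → σ → ℂ)
    (hp : ∀ j, p j ≠ 0) (f : MvPolynomial σ ℂ) :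
    f ∈ projVanishingIdeal
        ((Finset.univ.image fun j => Projectivization.mk ℂ (p j) (hp j) :
          Finset (Projectivization ℂ (σ → ℂ))) : Set (Projectivization ℂ (σ → ℂ))) ↔
      ∀ j (c : ℂ), eval (c • p j) f = 0 := by
  simp only [projVanishingIdeal, Finset.coe_image, Finset.coe_univ, Set.image_univ,
    Submodule.mem_iInf, Set.forall_mem_range, RingHom.mem_ker]
  refine forall_congr' fun j => ?_
  obtain ⟨a, ha⟩ := Projectivization.exists_smul_eq_mk_rep ℂ (p j) (hp j)
  rw [← ha]
  constructor
  · intro h c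
    simpa [Units.smul_def, smul_smul] using h (c * (a⁻¹ : ℂˣ))
  · intro h c
    simpa [Units.smul_def, smul_smul] using h (c * a)

/-- If `1` belongs to the family `e` and, modulo the ideal `I`, products of variables with members
of `e` are `ℂ[X k₀]`-linear combinations of `e`, then so is every polynomial. -/
theorem exists_sub_sum_mem {σ ι : Type*} [Fintype ι] (I : Ideal (MvPolynomial σ ℂ)) (k₀ : σ)
    (e : ι → MvPolynomial σ ℂ) (i₀ : ι) (he₀ : e i₀ = 1)
    (hmul : ∀ k, k ≠ k₀ → ∀ i, ∃ c : ι → Polynomial ℂ,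
      X k * e i - ∑ j, Polynomial.aeval (X k₀ : MvPolynomial σ ℂ) (c j) * e j ∈ I)
    (f : MvPolynomial σ ℂ) :
    ∃ c : ι → Polynomial ℂ,
      f - ∑ j, Polynomial.aeval (X k₀ : MvPolynomial σ ℂ) (c j) * e j ∈ I := by
  have hmul' : ∀ k i, ∃ c : ι → Polynomial ℂ,
      X k * e i - ∑ j, Polynomial.aeval (X k₀ : MvPolynomial σ ℂ) (c j) * e j ∈ I := by
    intro k i
    by_cases hk : k = k₀
    · refine ⟨Pi.single i Polynomial.X, ?_⟩
      simp [hk, Pi.single_apply, apply_ite, ite_mul]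
    · exact hmul k hk i
  choose m hm using hmul'
  induction f using MvPolynomial.induction_on with
  | C a =>
    refine ⟨Pi.single i₀ (Polynomial.C a), ?_⟩
    simp [Pi.single_apply, apply_ite, ite_mul, he₀, algebraMap_eq]
  | add f g hf hg =>
    obtain ⟨c, hc⟩ := hf
    obtain ⟨d, hd⟩ := hg
    refine ⟨c + d, ?_⟩
    convert I.add_mem hc hd using 1
    simp only [Pi.add_apply, map_add, add_mul, Finset.sum_add_distrib]
    ring
  | mul_X f k hf =>
    obtain ⟨c, hc⟩ := hf
    refine ⟨fun j => ∑ i, c i * m k i j, ?_⟩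
    have h := I.add_mem (I.mul_mem_left (X k) hc)
      (I.sum_mem fun i (_ : i ∈ Finset.univ) =>
        I.mul_mem_left (Polynomial.aeval (X k₀ : MvPolynomial σ ℂ) (c i)) (hm k i))
    convert h using 1
    simp only [map_sum, map_mul, Finset.sum_mul, mul_sub, Finset.mul_sum, Finset.sum_sub_distrib]
    rw [Finset.sum_comm]
    simp only [mul_assoc, mul_left_comm (X k)]
    ring

/-- Suppose that modulo `I` every polynomial is a `ℂ[X k₀]`-linear combination of the forms `e`,
that `I` vanishes on the lines through the points `p`, which lie on the affine chart `X k₀ = 1`,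
and that no nontrivial combination of `e` vanishes at all `p`. Then `I` is the vanishing ideal of
the corresponding projective points. -/
theorem exists_finset_eq_projVanishingIdeal {σ ι κ : Type*} [Fintype ι] [Fintype κ]
    (I : Ideal (MvPolynomial σ ℂ)) (k₀ : σ) (e : ι → MvPolynomial σ ℂ) (i₀ : ι) (he₀ : e i₀ = 1)
    (hmul : ∀ k, k ≠ k₀ → ∀ i, ∃ c : ι → Polynomial ℂ,
      X k * e i - ∑ j, Polynomial.aeval (X k₀ : MvPolynomial σ ℂ) (c j) * e j ∈ I)
    (d : ι → ℕ) (he : ∀ i (s : ℂ) v, eval (s • v) (e i) = s ^ d i * eval v (e i))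
    (p : κ → σ → ℂ) (hp : Function.Injective p) (hp₀ : ∀ j, p j k₀ = 1)
    (hI : ∀ f ∈ I, ∀ j (s : ℂ), eval (s • p j) f = 0)
    (hdet : ∀ a : ι → ℂ, (∀ j, ∑ i, a i * eval (p j) (e i) = 0) → ∀ i, a i = 0) :
    ∃ 𝕏 : Finset (Projectivization ℂ (σ → ℂ)),
      𝕏.card = Fintype.card κ ∧ I = projVanishingIdeal ↑𝕏 := by
  have hp0 : ∀ j, p j ≠ 0 := fun j h => by simpa [h] using hp₀ j
  refine ⟨Finset.univ.image fun j => Projectivization.mk ℂ (p j) (hp0 j), ?_, ?_⟩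
  · rw [Finset.card_image_of_injective, Finset.card_univ]
    intro i j hij
    obtain ⟨a, ha⟩ := (Projectivization.mk_eq_mk_iff' ℂ _ _ (hp0 i) (hp0 j)).1 hij
    have h1 : a = 1 := by simpa [hp₀] using congrFun ha k₀
    exact hp (by rw [← ha, h1, one_smul])
  ext f
  rw [mem_projVanishingIdeal_image_mk]
  refine ⟨fun hf => hI f hf, fun hf => ?_⟩
  obtain ⟨c, hc⟩ := exists_sub_sum_mem I k₀ e i₀ he₀ hmul f
  have hev : ∀ s : ℂ, ∀ i, (c i).eval s * s ^ d i = 0 := by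
    intro s
    refine hdet _ fun j => ?_
    have h := hI _ hc j s
    rw [map_sub, hf, zero_sub, neg_eq_zero, map_sum] at h
    rw [← h]
    refine Finset.sum_congr rfl fun i _ => ?_
    have h2 : eval (s • p j) (Polynomial.aeval (X k₀ : MvPolynomial σ ℂ) (c i)) =
        (c i).eval s := by
      rw [Polynomial.aeval_def, Polynomial.hom_eval₂]
      rw [algebraMap_eq, show (eval (s • p j)).comp C = RingHom.id ℂ by ext; simp]
      simp [Polynomial.eval₂_id, hp₀]
    rw [map_mul, he, h2]
    ring
  have hc0 : ∀ i, c i = 0 := by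
    intro i
    have h : c i * Polynomial.X ^ d i = 0 := Polynomial.funext fun s => by simpa using hev s i
    simpa using h
  simpa [hc0] using hc

theorem contract_single {σ : Type*} (i : σ) (n : ℕ) (k : σ →₀ ℕ) (a : ℂ) :
    contract (Finsupp.single i n) (monomial k a) =
      monomial (k - Finsupp.single i n) (a * Nat.descFactorial (k i) n) := by
  rw [contract_monomial, Finsupp.prod_single_index (by simp)]

theorem X_pow_mul_apolar {σ : Type*} (i : σ) (n : ℕ) (g F : MvPolynomial σ ℂ) :
    apolar (X i ^ n * g) F = contract (Finsupp.single i n) (apolar g F) := by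
  rw [X_pow_eq_monomial, monomial_mul_apolar, one_smul]

theorem X_pow_apolar {σ : Type*} (i : σ) (n : ℕ) (F : MvPolynomial σ ℂ) :
    apolar (X i ^ n) F = contract (Finsupp.single i n) F := by
  rw [X_pow_eq_monomial, apolar_monomial, one_smul]

theorem quartic_eq_monomial_add :
    (X 0 * ((X 1) ^ 3 + (X 2) ^ 3) : MvPolynomial (Fin 3) ℂ) =
      monomial (Finsupp.single 0 1 + Finsupp.single 1 3) 1 +
        monomial (Finsupp.single 0 1 + Finsupp.single 2 3) 1 := by
  rw [mul_add, X_pow_eq_monomial, X_pow_eq_monomial, X, monomial_mul, monomial_mul, mul_one]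

theorem X_one_mul_X_two_mem :
    X 1 * X 2 ∈ apolarIdeal (X 0 * ((X 1) ^ 3 + (X 2) ^ 3) : MvPolynomial (Fin 3) ℂ) := by
  rw [mem_apolarIdeal, ← pow_one (X 1), ← pow_one (X 2), X_pow_mul_apolar, X_pow_apolar, pow_one,
    pow_one, quartic_eq_monomial_add]
  simp [contract_add, contract_single]

theorem X_zero_sq_mem :
    X 0 ^ 2 ∈ apolarIdeal (X 0 * ((X 1) ^ 3 + (X 2) ^ 3) : MvPolynomial (Fin 3) ℂ) := by
  rw [mem_apolarIdeal, X_pow_apolar, quartic_eq_monomial_add]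
  simp [contract_add, contract_single]

theorem cubic_sub_cubic_mem :
    X 1 ^ 3 - X 2 ^ 3 ∈
      apolarIdeal (X 0 * ((X 1) ^ 3 + (X 2) ^ 3) : MvPolynomial (Fin 3) ℂ) := by
  rw [quartic_eq_monomial_add, mem_apolarIdeal, sub_eq_add_neg, add_apolar, ← neg_one_smul ℂ,
    X_pow_eq_monomial, X_pow_eq_monomial, smul_monomial, apolar_monomial, apolar_monomial]
  simp [contract_add, contract_single]

theorem cubic_mem :
    X 0 ^ 3 + X 1 ^ 3 - X 2 ^ 3 ∈
      apolarIdeal (X 0 * ((X 1) ^ 3 + (X 2) ^ 3) : MvPolynomial (Fin 3) ℂ) := by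
  have h := add_mem (Ideal.mul_mem_left _ (X 0) X_zero_sq_mem) cubic_sub_cubic_mem
  convert h using 1
  ring

theorem exists_injective_pow_three_eq_one :
    ∃ r : Fin 3 → ℂ, Function.Injective r ∧ ∀ i, r i ^ 3 = 1 := by
  have hz := Complex.isPrimitiveRoot_exp 3 (by norm_num)
  set z := Complex.exp (2 * Real.pi * Complex.I / (3 : ℕ))
  refine ⟨fun i => z ^ (i : ℕ), fun i j h => Fin.ext (hz.pow_inj i.2 j.2 h), fun i => ?_⟩
  rw [← pow_mul, mul_comm, pow_mul, hz.pow_eq_one, one_pow]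

theorem exists_injective_cyclotomic_nine_root :
    ∃ r : Fin 6 → ℂ, Function.Injective r ∧ ∀ i, r i ^ 6 + r i ^ 3 + 1 = 0 := by
  have hz := Complex.isPrimitiveRoot_exp 9 (by norm_num)
  have hcard : Fintype.card (primitiveRoots 9 ℂ) = 6 := by
    rw [Fintype.card_coe, hz.card_primitiveRoots]
    decide
  let E := (Fintype.equivFinOfCardEq hcard).symm
  refine ⟨fun i => E i, Subtype.val_injective.comp E.injective, fun i => ?_⟩
  have h := (mem_primitiveRoots (by norm_num)).1 (E i).2
  have h9 := h.pow_eq_one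
  have h3 := h.pow_ne_one_of_pos_of_lt (l := 3) (by norm_num) (by norm_num)
  refine (mul_eq_zero.1 (?_ : ((E i : ℂ) ^ 3 - 1) * _ = 0)).resolve_left (sub_ne_zero.2 h3)
  linear_combination h9

theorem eval_smul_eq_zero_of_mem_span_pair {σ κ : Type*} {f g : MvPolynomial σ ℂ} {p : κ → σ → ℂ}
    (hf : ∀ j (s : ℂ), eval (s • p j) f = 0) (hg : ∀ j (s : ℂ), eval (s • p j) g = 0) :
    ∀ h ∈ Ideal.span {f, g}, ∀ j (s : ℂ), eval (s • p j) h = 0 := by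
  intro h hh j s
  obtain ⟨a, b, rfl⟩ := Ideal.mem_span_pair.1 hh
  simp [hf, hg]

theorem exists_finset_monomial_conic :
    ∃ 𝕏 : Finset (Projectivization ℂ (Fin 3 → ℂ)), 𝕏.card = 6 ∧
      (Ideal.span {X 1 * X 2, (X 0) ^ 3 + (X 1) ^ 3 - (X 2) ^ 3} : Ideal (MvPolynomial (Fin 3) ℂ)) =
        projVanishingIdeal ↑𝕏 := by
  obtain ⟨r, hr, hr3⟩ := exists_injective_pow_three_eq_one
  have hr0 : ∀ i, r i ≠ 0 := fun i h => by simpa [h] using hr3 i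
  refine exists_finset_eq_projVanishingIdeal (κ := Fin 3 ⊕ Fin 3) _ 0
    ![1, X 1, X 2, X 1 ^ 2, X 2 ^ 2, X 1 ^ 3] 0 rfl ?_ ![0, 1, 1, 2, 2, 3] ?_
    (Sum.elim (fun i => ![1, -r i, 0]) fun i => ![1, 0, r i]) ?_ ?_ ?_ ?_
  · intro k hk i
    fin_cases k
    · exact absurd rfl hk
    · fin_cases i
      · refine ⟨![0, 1, 0, 0, 0, 0], Ideal.mem_span_pair.2 ⟨0, 0, ?_⟩⟩
        simp [Fin.sum_univ_six]
      · refine ⟨![0, 0, 0, 1, 0, 0], Ideal.mem_span_pair.2 ⟨0, 0, ?_⟩⟩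
        simp [Fin.sum_univ_six]; ring
      · refine ⟨0, Ideal.mem_span_pair.2 ⟨1, 0, ?_⟩⟩
        simp
      · refine ⟨![0, 0, 0, 0, 0, 1], Ideal.mem_span_pair.2 ⟨0, 0, ?_⟩⟩
        simp [Fin.sum_univ_six]; ring
      · refine ⟨0, Ideal.mem_span_pair.2 ⟨X 2, 0, ?_⟩⟩
        simp; ring
      · refine ⟨![0, -Polynomial.X ^ 3, 0, 0, 0, 0],
          Ideal.mem_span_pair.2 ⟨X 2 ^ 2, X 1, ?_⟩⟩
        simp [Fin.sum_univ_six]; ring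
    · fin_cases i
      · refine ⟨![0, 0, 1, 0, 0, 0], Ideal.mem_span_pair.2 ⟨0, 0, ?_⟩⟩
        simp [Fin.sum_univ_six]
      · refine ⟨0, Ideal.mem_span_pair.2 ⟨1, 0, ?_⟩⟩
        simp; ring
      · refine ⟨![0, 0, 0, 0, 1, 0], Ideal.mem_span_pair.2 ⟨0, 0, ?_⟩⟩
        simp [Fin.sum_univ_six]; ring
      · refine ⟨0, Ideal.mem_span_pair.2 ⟨X 1, 0, ?_⟩⟩
        simp; ring
      · refine ⟨![Polynomial.X ^ 3, 0, 0, 0, 0, 1], Ideal.mem_span_pair.2 ⟨0, -1, ?_⟩⟩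
        simp [Fin.sum_univ_six]; ring
      · refine ⟨0, Ideal.mem_span_pair.2 ⟨X 1 ^ 2, 0, ?_⟩⟩
        simp; ring
  · intro i s v
    fin_cases i <;> simp <;> ring
  · rintro (i | i) (j | j) h
    · have h1 := congrFun h 1
      simp only [Sum.elim_inl, Matrix.cons_val_one, Matrix.cons_val_zero, neg_inj] at h1
      rw [hr h1]
    · have h2 := congrFun h 2
      simp at h2
      exact absurd h2.symm (hr0 j)
    · have h2 := congrFun h 2
      simp at h2
      exact absurd h2 (hr0 i)
    · have h2 := congrFun h 2
      simp at h2
      rw [hr h2]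
  · rintro (i | i) <;> simp
  · refine eval_smul_eq_zero_of_mem_span_pair ?_ ?_
    · rintro (i | i) s <;> simp
    · rintro (i | i) s
      · simp
        linear_combination (-s ^ 3) * hr3 i
      · simp
        linear_combination (-s ^ 3) * hr3 i
  · intro a ha
    have h1 := Matrix.eq_zero_of_forall_index_sum_pow_mul_eq_zero (v := ![a 0 - a 5, -a 1, a 3]) hr
      fun j => by
        have h := ha (Sum.inl j)
        simp [Fin.sum_univ_six] at h
        simp [Fin.sum_univ_three]
        linear_combination h + a 5 * hr3 j
    have h2 := Matrix.eq_zero_of_forall_index_sum_pow_mul_eq_zero (v := ![a 0, a 2, a 4]) hr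
      fun j => by
        have h := ha (Sum.inr j)
        simp [Fin.sum_univ_six] at h
        simp [Fin.sum_univ_three]
        linear_combination h
    have e0 : a 0 - a 5 = 0 := congrFun h1 0
    have e1 : -a 1 = 0 := congrFun h1 1
    have e3 : a 3 = 0 := congrFun h1 2
    have f0 : a 0 = 0 := congrFun h2 0
    have f2 : a 2 = 0 := congrFun h2 1
    have f4 : a 4 = 0 := congrFun h2 2
    intro i
    fin_cases i
    · exact f0
    · exact neg_eq_zero.1 e1
    · exact f2
    · exact e3
    · exact f4
    · change a 5 = 0
      linear_combination f0 - e0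

theorem exists_finset_smooth_conic :
    ∃ 𝕏 : Finset (Projectivization ℂ (Fin 3 → ℂ)), 𝕏.card = 6 ∧
      (Ideal.span {(X 0) ^ 2 + X 1 * X 2, (X 0) ^ 3 + (X 1) ^ 3 - (X 2) ^ 3} :
        Ideal (MvPolynomial (Fin 3) ℂ)) = projVanishingIdeal ↑𝕏 := by
  obtain ⟨r, hr, hr9⟩ := exists_injective_cyclotomic_nine_root
  refine exists_finset_eq_projVanishingIdeal (κ := Fin 6) _ 1
    ![1, X 0, X 2, X 0 * X 2, X 2 ^ 2, X 0 * X 2 ^ 2] 0 rfl ?_ ![0, 1, 1, 2, 2, 3] ?_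
    (fun i => ![r i, 1, -r i ^ 2]) ?_ ?_ ?_ ?_
  · intro k hk i
    fin_cases k
    · fin_cases i
      · refine ⟨![0, 1, 0, 0, 0, 0], Ideal.mem_span_pair.2 ⟨0, 0, ?_⟩⟩
        simp [Fin.sum_univ_six]
      · refine ⟨![0, 0, -Polynomial.X, 0, 0, 0], Ideal.mem_span_pair.2 ⟨1, 0, ?_⟩⟩
        simp [Fin.sum_univ_six]; ring
      · refine ⟨![0, 0, 0, 1, 0, 0], Ideal.mem_span_pair.2 ⟨0, 0, ?_⟩⟩
        simp [Fin.sum_univ_six]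
      · refine ⟨![0, 0, 0, 0, -Polynomial.X, 0], Ideal.mem_span_pair.2 ⟨X 2, 0, ?_⟩⟩
        simp [Fin.sum_univ_six]; ring
      · refine ⟨![0, 0, 0, 0, 0, 1], Ideal.mem_span_pair.2 ⟨0, 0, ?_⟩⟩
        simp [Fin.sum_univ_six]
      · refine ⟨![-Polynomial.X ^ 4, 0, 0, Polynomial.X ^ 2, 0, 0],
          Ideal.mem_span_pair.2 ⟨X 2 ^ 2 - X 0 * X 1, X 1, ?_⟩⟩
        simp [Fin.sum_univ_six]; ring
    · exact absurd rfl hk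
    · fin_cases i
      · refine ⟨![0, 0, 1, 0, 0, 0], Ideal.mem_span_pair.2 ⟨0, 0, ?_⟩⟩
        simp [Fin.sum_univ_six]
      · refine ⟨![0, 0, 0, 1, 0, 0], Ideal.mem_span_pair.2 ⟨0, 0, ?_⟩⟩
        simp [Fin.sum_univ_six]; ring
      · refine ⟨![0, 0, 0, 0, 1, 0], Ideal.mem_span_pair.2 ⟨0, 0, ?_⟩⟩
        simp [Fin.sum_univ_six]; ring
      · refine ⟨![0, 0, 0, 0, 0, 1], Ideal.mem_span_pair.2 ⟨0, 0, ?_⟩⟩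
        simp [Fin.sum_univ_six]; ring
      · refine ⟨![Polynomial.X ^ 3, 0, 0, -Polynomial.X, 0, 0],
          Ideal.mem_span_pair.2 ⟨X 0, -1, ?_⟩⟩
        simp [Fin.sum_univ_six]; ring
      · refine ⟨![0, Polynomial.X ^ 3, 0, 0, Polynomial.X ^ 2, 0],
          Ideal.mem_span_pair.2 ⟨X 0 ^ 2 - X 1 * X 2, -X 0, ?_⟩⟩
        simp [Fin.sum_univ_six]; ring
  · intro i s v
    fin_cases i <;> simp <;> ring
  · intro i j h
    exact hr (by simpa using congrFun h 0)
  · simp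
  · refine eval_smul_eq_zero_of_mem_span_pair ?_ ?_
    · intro i s
      simp
      ring
    · intro i s
      simp
      linear_combination s ^ 3 * hr9 i
  · intro a ha
    have h1 := Matrix.eq_zero_of_forall_index_sum_pow_mul_eq_zero
      (v := ![a 0, a 1, -a 2, -a 3, a 4, a 5]) hr fun j => by
        have h := ha j
        simp [Fin.sum_univ_six] at h
        simp [Fin.sum_univ_six]
        linear_combination h
    intro i
    have h := congrFun h1 i
    fin_cases i <;> simpa using h

/-- For `F = x(y_1^3 + y_2^3)`, both ideals `(Y_1Y_2, X^3 + Y_1^3 − Y_2^3)` and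
`(X^2 + Y_1Y_2, X^3 + Y_1^3 − Y_2^3)` are contained in `F^⊥` and each is the
vanishing ideal of a (reduced) set of `6` distinct points of `ℙ^2`. -/
theorem statement4 :
    let F : MvPolynomial (Fin 3) ℂ := X 0 * ((X 1) ^ 3 + (X 2) ^ 3)
    let I₁ : Ideal (MvPolynomial (Fin 3) ℂ) :=
      Ideal.span {X 1 * X 2, (X 0) ^ 3 + (X 1) ^ 3 - (X 2) ^ 3}
    let I₂ : Ideal (MvPolynomial (Fin 3) ℂ) :=
      Ideal.span {(X 0) ^ 2 + X 1 * X 2, (X 0) ^ 3 + (X 1) ^ 3 - (X 2) ^ 3}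
    (∀ g ∈ I₁, apolar g F = 0) ∧ (∀ g ∈ I₂, apolar g F = 0) ∧
    (∃ 𝕏 : Finset (Projectivization ℂ (Fin 3 → ℂ)),
      𝕏.card = 6 ∧ I₁ = projVanishingIdeal ↑𝕏) ∧
    (∃ 𝕏 : Finset (Projectivization ℂ (Fin 3 → ℂ)),
      𝕏.card = 6 ∧ I₂ = projVanishingIdeal ↑𝕏) := by
  intro F I₁ I₂
  have h₁ : I₁ ≤ apolarIdeal F :=
    Ideal.span_le.2 (Set.pair_subset X_one_mul_X_two_mem cubic_mem)
  have h₂ : I₂ ≤ apolarIdeal F :=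
    Ideal.span_le.2 (Set.pair_subset (add_mem X_zero_sq_mem X_one_mul_X_two_mem) cubic_mem)
  exact ⟨fun g hg => h₁ hg, fun g hg => h₂ hg, exists_finset_monomial_conic, exists_finset_smooth_conic⟩
end

section
/- In T = ℂ[X_1, X_2, Y_1, ..., Y_n] with the lexicographic order X_1 > X_2 > Y_1 > ... > Y_n, the set G = {Y_iY_j : 1 ≤ i < j ≤ n} ∪ {Q_1, Q_2}, where Q_1 = X_1^2 + Σ_{i=2}^n α_i(Y_1^2 − Y_i^2) and Q_2 = X_2^2 + Σ_{i=2}^n β_i(Y_1^2 − Y_i^2) for arbitrary α_i, β_i ∈ ℂ, is a Gröbner basis of the ideal it generates; in particular the initial ideal is ({Y_iY_j}_{1≤i<j≤n}, X_1^2, X_2^2). -/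
open MvPolynomial
open scoped Classical

/-- `mo` is the lexicographic leading monomial of `f`, for the lex order in which
`X 0 > X 1 > …` (larger exponent on an earlier variable wins). -/
def IsLexLeadMon {N : ℕ} (f : MvPolynomial (Fin N) ℂ) (mo : Fin N →₀ ℕ) : Prop :=
  mo ∈ f.support ∧ ∀ m' ∈ f.support, toLex m' ≤ toLex mo

/-- The initial ideal of `I` with respect to the lexicographic order: the ideal generated
by the leading monomials of the nonzero elements of `I`. -/
noncomputable def lexInitialIdeal {N : ℕ} (I : Ideal (MvPolynomial (Fin N) ℂ)) :
    Ideal (MvPolynomial (Fin N) ℂ) :=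
  Ideal.span {p | ∃ f ∈ I, f ≠ 0 ∧ ∃ mo, IsLexLeadMon f mo ∧ p = monomial mo 1}

/-- The quadric `X_a ^ 2 + ∑ γ_j Y_j ^ 2`, where `Y_j` is the variable of index `j + 2`. -/
noncomputable def diagQuadric {n : ℕ} (a : Fin (n + 2)) (γ : Fin n → ℂ) :
    MvPolynomial (Fin (n + 2)) ℂ :=
  X a ^ 2 + ∑ j, C (γ j) * X j.succ.succ ^ 2

theorem exists_sum_erase_eq_sum_sq {ι R : Type*} [Fintype ι] [DecidableEq ι] [CommRing R] (i₀ : ι) (α : ι → R) :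
    ∃ γ : ι → R, ∀ {S : Type*} [CommRing S] (φ : R →+* S) (y : ι → S),
      ∑ i ∈ Finset.univ.erase i₀, φ (α i) * (y i₀ ^ 2 - y i ^ 2) = ∑ i, φ (γ i) * y i ^ 2 := by
  refine ⟨fun i => if i = i₀ then ∑ j ∈ Finset.univ.erase i₀, α j else -α i, ?_⟩
  intro S _ φ y
  rw [← Finset.add_sum_erase Finset.univ (fun i => φ _ * _) (Finset.mem_univ i₀)]
  simp only [if_true]
  rw [map_sum, Finset.sum_mul,
    ← Finset.sum_add_distrib]
  refine Finset.sum_congr rfl fun i hi => ?_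
  rw [if_neg (Finset.ne_of_mem_erase hi), map_neg]
  ring

theorem toLex_single_lt {n : ℕ} {a b : Fin n} (hab : a < b) {k l : ℕ} (hk : 0 < k) :
    toLex (Finsupp.single b l) < toLex (Finsupp.single a k) := by
  rw [Finsupp.Lex.lt_iff]
  refine ⟨a, fun j hj => ?_, ?_⟩
  · simp [hj.ne', (hj.trans hab).ne']
  · simpa [Finsupp.single_apply, hab.ne'] using hk

theorem isLexLeadMon_monomial {n : ℕ} (m : Fin n →₀ ℕ) :
    IsLexLeadMon (monomial m (1 : ℂ)) m := by
  simp [IsLexLeadMon, support_monomial]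

theorem coeff_diagQuadric {n : ℕ} (a : Fin (n + 2)) (γ : Fin n → ℂ) (m : Fin (n + 2) →₀ ℕ) :
    coeff m (diagQuadric a γ) = (if Finsupp.single a 2 = m then 1 else 0) +
      ∑ j, γ j * if Finsupp.single j.succ.succ 2 = m then 1 else 0 := by
  simp [diagQuadric, coeff_X_pow, coeff_sum, coeff_C_mul]

theorem isLexLeadMon_diagQuadric {n : ℕ} {a : Fin (n + 2)} (ha : ∀ j : Fin n, a < j.succ.succ)
    (γ : Fin n → ℂ) : IsLexLeadMon (diagQuadric a γ) (Finsupp.single a 2) := by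
  constructor
  · rw [mem_support_iff, coeff_diagQuadric, Finset.sum_eq_zero]
    · simp
    · intro j _
      rw [if_neg, mul_zero]
      intro h
      exact (ha j).ne' (Finsupp.single_left_injective two_ne_zero h)
  · intro m hm
    rw [mem_support_iff, coeff_diagQuadric] at hm
    by_contra! hlt
    refine hm ?_
    rw [if_neg (fun h => by simp [h] at hlt), zero_add, Finset.sum_eq_zero]
    intro j _
    rw [if_neg, mul_zero]
    rintro rfl
    exact lt_asymm hlt (toLex_single_lt (ha j) two_pos)

/-- The coefficient of the standard monomial `m` in the normal form of the monomial `e` modulo the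
`Y_j Y_l` (`j ≠ l`) and the quadrics `X_0 ^ 2 + ∑ γ_j Y_j ^ 2`, `X_1 ^ 2 + ∑ δ_j Y_j ^ 2`,
when `m` involves only `X_0`, `X_1` and `Y_i`. -/
noncomputable def normalFormWeight {n : ℕ} (γ δ : Fin n → ℂ) (i : Fin n) (m e : Fin (n + 2) →₀ ℕ) :
    ℂ :=
  if (∀ j, j ≠ i → e j.succ.succ = 0) ∧ e 0 % 2 = m 0 ∧ e 1 % 2 = m 1 ∧
      e 0 + e 1 + e i.succ.succ = m 0 + m 1 + m i.succ.succ then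
    (-γ i) ^ (e 0 / 2) * (-δ i) ^ (e 1 / 2)
  else 0

section NormalForm

variable {n : ℕ} (γ δ : Fin n → ℂ) (i : Fin n) (m : Fin (n + 2) →₀ ℕ)

/-- The linear functional sending `f` to the coefficient of `m` in its normal form. -/
noncomputable def normalFormCoeff : MvPolynomial (Fin (n + 2)) ℂ →ₗ[ℂ] ℂ :=
  (basisMonomials (Fin (n + 2)) ℂ).constr ℂ (normalFormWeight γ δ i m)

theorem normalFormCoeff_monomial (e : Fin (n + 2) →₀ ℕ) (c : ℂ) :
    normalFormCoeff γ δ i m (monomial e c) = c * normalFormWeight γ δ i m e := by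
  have h : monomial e c = c • basisMonomials (Fin (n + 2)) ℂ e := by
    simp [smul_monomial]
  rw [h, map_smul, normalFormCoeff, Module.Basis.constr_basis, smul_eq_mul]

theorem normalFormCoeff_eq_sum (f : MvPolynomial (Fin (n + 2)) ℂ) :
    normalFormCoeff γ δ i m f = ∑ e ∈ f.support, coeff e f * normalFormWeight γ δ i m e := by
  conv_lhs => rw [f.as_sum]
  simp only [map_sum, normalFormCoeff_monomial]

theorem normalFormWeight_eq_zero {e : Fin (n + 2) →₀ ℕ} {j : Fin n} (hj : j ≠ i)
    (he : e j.succ.succ ≠ 0) : normalFormWeight γ δ i m e = 0 :=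
  if_neg fun h => he (h.1 j hj)

theorem normalFormWeight_add_X_zero_sq (e : Fin (n + 2) →₀ ℕ) :
    normalFormWeight γ δ i m (e + Finsupp.single 0 2) =
      -γ i * normalFormWeight γ δ i m (e + Finsupp.single i.succ.succ 2) := by
  have h0 : ∀ j : Fin n, j.succ.succ ≠ 0 := fun j => Fin.succ_ne_zero _
  have h1 : ∀ j : Fin n, j.succ.succ ≠ 1 := fun j => by simp [Fin.ext_iff]
  have h : ∀ j, j ≠ i → (e + Finsupp.single i.succ.succ 2 : Fin (n + 2) →₀ ℕ) j.succ.succ = e j.succ.succ :=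
    fun j hj => by simp [hj.symm]
  have h' : ∀ j : Fin n, (e + Finsupp.single 0 2 : Fin (n + 2) →₀ ℕ) j.succ.succ = e j.succ.succ :=
    fun j => by simp
  unfold normalFormWeight
  simp +contextual only [h, h', Finsupp.add_apply, Finsupp.single_eq_same, ne_eq, h0, h1,
    Finsupp.single_apply, zero_ne_one, if_false, add_zero, Nat.add_mod_right,
    not_false_eq_true, Nat.add_div_right, two_pos]
  simp only [add_right_comm _ 2, ← add_assoc, mul_ite, mul_zero]
  refine if_congr Iff.rfl ?_ rfl
  rw [pow_succ]
  ring

theorem normalFormWeight_add_X_one_sq (e : Fin (n + 2) →₀ ℕ) :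
    normalFormWeight γ δ i m (e + Finsupp.single 1 2) =
      -δ i * normalFormWeight γ δ i m (e + Finsupp.single i.succ.succ 2) := by
  have h0 : ∀ j : Fin n, j.succ.succ ≠ 0 := fun j => Fin.succ_ne_zero _
  have h1 : ∀ j : Fin n, j.succ.succ ≠ 1 := fun j => by simp [Fin.ext_iff]
  have h : ∀ j, j ≠ i → (e + Finsupp.single i.succ.succ 2 : Fin (n + 2) →₀ ℕ) j.succ.succ = e j.succ.succ :=
    fun j hj => by simp [hj.symm]
  have h' : ∀ j : Fin n, (e + Finsupp.single 1 2 : Fin (n + 2) →₀ ℕ) j.succ.succ = e j.succ.succ :=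
    fun j => by simp [(h1 j).symm]
  unfold normalFormWeight
  simp +contextual only [h, h', Finsupp.add_apply, Finsupp.single_eq_same, ne_eq, h0, h1,
    Finsupp.single_apply, one_ne_zero, if_false, add_zero, Nat.add_mod_right,
    not_false_eq_true, Nat.add_div_right, two_pos]
  simp only [add_right_comm _ 2, ← add_assoc, mul_ite, mul_zero]
  refine if_congr Iff.rfl ?_ rfl
  rw [pow_succ]
  ring

theorem normalFormCoeff_monomial_mul_diagQuadric {a : Fin (n + 2)} {ε : Fin n → ℂ}
    (h : ∀ e, normalFormWeight γ δ i m (e + Finsupp.single a 2) =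
      -ε i * normalFormWeight γ δ i m (e + Finsupp.single i.succ.succ 2))
    (e : Fin (n + 2) →₀ ℕ) (c : ℂ) :
    normalFormCoeff γ δ i m (monomial e c * diagQuadric a ε) = 0 := by
  simp only [diagQuadric, X_pow_eq_monomial, C_mul_monomial, mul_add, Finset.mul_sum,
    monomial_mul, map_add, map_sum, normalFormCoeff_monomial]
  rw [Finset.sum_eq_single i, h]
  · ring
  · intro j _ hj
    rw [normalFormWeight_eq_zero γ δ i m hj (by simp), mul_zero]
  · simp

theorem normalFormCoeff_monomial_mul_X_mul_X {j l : Fin n} (hjl : j ≠ l)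
    (e : Fin (n + 2) →₀ ℕ) (c : ℂ) :
    normalFormCoeff γ δ i m (monomial e c * (X j.succ.succ * X l.succ.succ)) = 0 := by
  simp only [X, monomial_mul, normalFormCoeff_monomial]
  rcases eq_or_ne j i with rfl | hj
  · rw [normalFormWeight_eq_zero γ δ j m hjl.symm (by simp), mul_zero]
  · rw [normalFormWeight_eq_zero γ δ i m hj (by simp), mul_zero]

theorem normalFormCoeff_eq_zero_of_mem_span {f : MvPolynomial (Fin (n + 2)) ℂ}
    (hf : f ∈ Ideal.span ({p | ∃ j l : Fin n, j < l ∧ p = X j.succ.succ * X l.succ.succ} ∪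
      {diagQuadric 0 γ, diagQuadric 1 δ})) : normalFormCoeff γ δ i m f = 0 := by
  suffices h : ∀ g, normalFormCoeff γ δ i m (g * f) = 0 by simpa using h 1
  induction hf using Submodule.span_induction with
  | zero => simp
  | add p q _ _ hp hq => intro g; rw [mul_add, map_add, hp, hq, add_zero]
  | smul a p _ hp => intro g; rw [smul_eq_mul, ← mul_assoc, hp]
  | mem p hp =>
    intro g
    rw [g.as_sum, Finset.sum_mul, map_sum]
    refine Finset.sum_eq_zero fun e _ => ?_
    rcases hp with ⟨j, l, hjl, rfl⟩ | rfl | rfl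
    · exact normalFormCoeff_monomial_mul_X_mul_X γ δ i m hjl.ne e _
    · exact normalFormCoeff_monomial_mul_diagQuadric γ δ i m
        (normalFormWeight_add_X_zero_sq γ δ i m) e _
    · exact normalFormCoeff_monomial_mul_diagQuadric γ δ i m
        (normalFormWeight_add_X_one_sq γ δ i m) e _

variable {γ δ i m}

theorem normalFormCoeff_eq_coeff_of_isLexLeadMon {f : MvPolynomial (Fin (n + 2)) ℂ}
    (hf : IsLexLeadMon f m) (h0 : m 0 < 2) (h1 : m 1 < 2)
    (hm : ∀ j, j ≠ i → m j.succ.succ = 0) : normalFormCoeff γ δ i m f = coeff m f := by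
  rw [normalFormCoeff_eq_sum, Finset.sum_eq_single_of_mem m hf.1]
  · rw [normalFormWeight, if_pos ⟨hm, Nat.mod_eq_of_lt h0, Nat.mod_eq_of_lt h1, rfl⟩,
      Nat.div_eq_of_lt h0, Nat.div_eq_of_lt h1]
    simp
  · intro e he hne
    rw [normalFormWeight, if_neg, mul_zero]
    rintro ⟨hY, hX₀, hX₁, hdeg⟩
    refine (hf.2 e he).not_gt ?_
    rw [Finsupp.Lex.lt_iff]
    rcases eq_or_ne (e 0) (m 0) with h₀ | h₀
    · rcases eq_or_ne (e 1) (m 1) with h₁ | h₁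
      · refine absurd (Finsupp.ext fun k => ?_) hne
        induction k using Fin.cases with
        | zero => exact h₀
        | succ k =>
          induction k using Fin.cases with
          | zero => exact h₁
          | succ k =>
            rcases eq_or_ne k i with rfl | hk
            · omega
            · rw [hY k hk, hm k hk]
      · refine ⟨1, fun j hj => ?_, ?_⟩
        · have : j = 0 := by
            rw [Fin.lt_def] at hj
            exact Fin.ext (by simpa using hj)
          subst this
          exact h₀.symm
        · change m 1 < e 1
          omega
    · refine ⟨0, fun j hj => absurd hj (Fin.not_lt_zero j), ?_⟩
      change m 0 < e 0
      omega

end NormalForm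

theorem lexInitialIdeal_le {n : ℕ} (hn : 0 < n) (γ δ : Fin n → ℂ) :
    lexInitialIdeal (Ideal.span
      ({p | ∃ j l : Fin n, j < l ∧ p = X j.succ.succ * X l.succ.succ} ∪
        {diagQuadric 0 γ, diagQuadric 1 δ})) ≤
      Ideal.span ({p | ∃ j l : Fin n, j < l ∧ p = X j.succ.succ * X l.succ.succ} ∪
        {(X 0 : MvPolynomial (Fin (n + 2)) ℂ) ^ 2, (X 1) ^ 2}) := by
  refine Ideal.span_le.2 ?_
  rintro _ ⟨f, hf, -, m, hm, rfl⟩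
  set J := Ideal.span ({p | ∃ j l : Fin n, j < l ∧ p = X j.succ.succ * X l.succ.succ} ∪
        {(X 0 : MvPolynomial (Fin (n + 2)) ℂ) ^ 2, (X 1) ^ 2})
  have dvd_mem : ∀ {e : Fin (n + 2) →₀ ℕ}, monomial e (1 : ℂ) ∈ J → e ≤ m → monomial m 1 ∈ J :=
    fun he hem => J.mem_of_dvd (monomial_dvd_monomial.2 ⟨Or.inr hem, dvd_rfl⟩) he
  by_contra hmJ
  have hX : ∀ a : Fin (n + 2), (X a : MvPolynomial (Fin (n + 2)) ℂ) ^ 2 ∈ J → m a < 2 := by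
    intro a ha
    by_contra! h
    rw [X_pow_eq_monomial] at ha
    exact hmJ (dvd_mem ha (Finsupp.single_le_iff.2 h))
  have h0 : m 0 < 2 := hX 0 (Ideal.subset_span (by simp))
  have h1 : m 1 < 2 := hX 1 (Ideal.subset_span (by simp))
  have hY : ∀ j l : Fin n, j < l → m j.succ.succ = 0 ∨ m l.succ.succ = 0 := by
    intro j l hjl
    by_contra! h
    refine hmJ (dvd_mem (e := Finsupp.single j.succ.succ 1 + Finsupp.single l.succ.succ 1) ?_ ?_)
    · refine Ideal.subset_span (Or.inl ⟨j, l, hjl, ?_⟩)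
      simp [X, monomial_mul]
    · intro k
      have := hjl.ne
      simp only [Finsupp.add_apply, Finsupp.single_apply]
      split_ifs with hj hl hl
      · exact absurd (Fin.succ_injective _ (Fin.succ_injective _ (hj.trans hl.symm))) this
      · subst hj; omega
      · subst hl; omega
      · omega
  obtain ⟨i, hi⟩ : ∃ i : Fin n, ∀ j, j ≠ i → m j.succ.succ = 0 := by
    by_cases h : ∃ i : Fin n, m i.succ.succ ≠ 0
    · obtain ⟨i, hi⟩ := h
      refine ⟨i, fun j hj => ?_⟩
      rcases lt_or_gt_of_ne hj with hj | hj
      · exact (hY j i hj).resolve_right hi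
      · exact (hY i j hj).resolve_left hi
    · push Not at h
      exact ⟨⟨0, hn⟩, fun j _ => h j⟩
  refine mem_support_iff.1 hm.1 ?_
  rw [← normalFormCoeff_eq_coeff_of_isLexLeadMon hm h0 h1 hi]
  exact normalFormCoeff_eq_zero_of_mem_span γ δ i m hf

/-- In `ℂ[X_1, X_2, Y_1, …, Y_n]` with the lex order `X_1 > X_2 > Y_1 > ⋯ > Y_n`, the set
`G = {Y_iY_j}_{i<j} ∪ {Q_1, Q_2}` with `Q_1 = X_1^2 + Σ α_i(Y_1^2 − Y_i^2)`,
`Q_2 = X_2^2 + Σ β_i(Y_1^2 − Y_i^2)` is a Gröbner basis of the ideal it generates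
(the leading monomials of `G` generate the initial ideal); in particular the initial
ideal is `({Y_iY_j}_{i<j}, X_1^2, X_2^2)`. -/
theorem statement9 (n : ℕ) (hn : 2 ≤ n) (α β : Fin n → ℂ) :
    let Y : Fin n → MvPolynomial (Fin (n + 2)) ℂ := fun i => X i.succ.succ
    let Q₁ : MvPolynomial (Fin (n + 2)) ℂ := (X 0) ^ 2 +
      ∑ i ∈ Finset.univ.erase ⟨0, by omega⟩, C (α i) * ((Y ⟨0, by omega⟩) ^ 2 - (Y i) ^ 2)
    let Q₂ : MvPolynomial (Fin (n + 2)) ℂ := (X 1) ^ 2 +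
      ∑ i ∈ Finset.univ.erase ⟨0, by omega⟩, C (β i) * ((Y ⟨0, by omega⟩) ^ 2 - (Y i) ^ 2)
    let G : Set (MvPolynomial (Fin (n + 2)) ℂ) :=
      {p | ∃ i j : Fin n, i < j ∧ p = Y i * Y j} ∪ {Q₁, Q₂}
    Ideal.span {p | ∃ g ∈ G, g ≠ 0 ∧ ∃ mo, IsLexLeadMon g mo ∧ p = monomial mo 1} =
        lexInitialIdeal (Ideal.span G) ∧
    lexInitialIdeal (Ideal.span G) =
      Ideal.span ({p | ∃ i j : Fin n, i < j ∧ p = Y i * Y j} ∪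
        {(X 0 : MvPolynomial (Fin (n + 2)) ℂ) ^ 2, (X 1) ^ 2}) := by
  intro Y Q₁ Q₂ G
  obtain ⟨γ, hγ⟩ := exists_sum_erase_eq_sum_sq (⟨0, by omega⟩ : Fin n) α
  obtain ⟨δ, hδ⟩ := exists_sum_erase_eq_sum_sq (⟨0, by omega⟩ : Fin n) β
  have hQ₁ : Q₁ = diagQuadric 0 γ := congrArg (X 0 ^ 2 + ·) (hγ C Y)
  have hQ₂ : Q₂ = diagQuadric 1 δ := congrArg (X 1 ^ 2 + ·) (hδ C Y)
  have hlead₁ : IsLexLeadMon Q₁ (Finsupp.single 0 2) :=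
    hQ₁ ▸ isLexLeadMon_diagQuadric (fun j => Fin.succ_pos _) γ
  have hlead₂ : IsLexLeadMon Q₂ (Finsupp.single 1 2) :=
    hQ₂ ▸ isLexLeadMon_diagQuadric (fun j => by simp [Fin.lt_def]) δ
  have ne_zero : ∀ {f : MvPolynomial (Fin (n + 2)) ℂ} {m}, IsLexLeadMon f m → f ≠ 0 := by
    rintro f m hf rfl
    simpa using hf.1
  have hGI : Ideal.span {p | ∃ g ∈ G, g ≠ 0 ∧ ∃ mo, IsLexLeadMon g mo ∧ p = monomial mo 1} ≤
      lexInitialIdeal (Ideal.span G) :=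
    Ideal.span_mono fun _ ⟨g, hg, h⟩ => ⟨g, Ideal.subset_span hg, h⟩
  have hIM : lexInitialIdeal (Ideal.span G) ≤
      Ideal.span ({p | ∃ i j : Fin n, i < j ∧ p = Y i * Y j} ∪
        {(X 0 : MvPolynomial (Fin (n + 2)) ℂ) ^ 2, (X 1) ^ 2}) := by
    simp only [G, hQ₁, hQ₂]
    exact lexInitialIdeal_le (by omega) γ δ
  have hMG : Ideal.span ({p | ∃ i j : Fin n, i < j ∧ p = Y i * Y j} ∪
        {(X 0 : MvPolynomial (Fin (n + 2)) ℂ) ^ 2, (X 1) ^ 2}) ≤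
      Ideal.span {p | ∃ g ∈ G, g ≠ 0 ∧ ∃ mo, IsLexLeadMon g mo ∧ p = monomial mo 1} := by
    refine Ideal.span_mono ?_
    rintro _ (⟨i, j, hij, rfl⟩ | rfl | rfl)
    · have h : Y i * Y j =
          monomial (Finsupp.single i.succ.succ 1 + Finsupp.single j.succ.succ 1) 1 := by
        simp [Y, X, monomial_mul]
      have hlead := h ▸ isLexLeadMon_monomial
        (Finsupp.single i.succ.succ 1 + Finsupp.single j.succ.succ 1)
      exact ⟨_, Or.inl ⟨i, j, hij, rfl⟩, ne_zero hlead, _, hlead, h⟩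
    · exact ⟨Q₁, by simp [G], ne_zero hlead₁, _, hlead₁, X_pow_eq_monomial⟩
    · exact ⟨Q₂, by simp [G], ne_zero hlead₂, _, hlead₂, X_pow_eq_monomial⟩
  exact ⟨le_antisymm hGI (hIM.trans hMG), le_antisymm hIM (hMG.trans hGI)⟩
end
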